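/- Let k be an algebraically closed field of characteristic zero and n ≥ 1. Let D° ⊆ M_n(k) be the set of all products ū·ĥ·u where ū is lower triangular with all diagonal entries 1, u is upper triangular with all diagonal entries 1, and ĥ is a diagonal matrix whose first n−1 diagonal entries are nonzero and whose last diagonal entry is 0. Then every polynomial in the n² matrix entries with coefficients in k that vanishes at every point of D° also vanishes at every matrix M ∈ M_n(k) with det M = 0; equivalently, D° is Zariski dense in the determinantal hypersurface D = {M ∈ M_n(k) : det M = 0}. -/

import Mathlib

open Polynomial in
/-- A polynomial in the entries of a matrix that vanishes at a curve of matrices for all parameters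
outside the zero set of a nonzero polynomial vanishes along the whole curve. -/
theorem MvPolynomial.eval_curve_eq_zero {k σ : Type*} [Field k] [Infinite k]
    (p : MvPolynomial σ k) (c : σ → k[X]) (g : k[X]) (hg : g ≠ 0)
    (h : ∀ t : k, g.eval t ≠ 0 → MvPolynomial.eval (fun s => (c s).eval t) p = 0) (t : k) :
    MvPolynomial.eval (fun s => (c s).eval t) p = 0 := by
  have key : ∀ t : k, (MvPolynomial.aeval c p).eval t =
      MvPolynomial.eval (fun s => (c s).eval t) p := by
    clear h
    intro t
    induction p using MvPolynomial.induction_on with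
    | C a => simp
    | add p q hp hq => simp_all
    | mul_X p s hp => simp_all
  have hq : MvPolynomial.aeval c p * g = 0 := by
    refine Polynomial.funext fun t => ?_
    by_cases ht : g.eval t = 0
    · simp [ht]
    · simp [key, h t ht]
  rw [← key, (mul_eq_zero.mp hq).resolve_right hg, Polynomial.eval_zero]

namespace Matrix

/-- A matrix whose proper leading principal minors do not vanish has an LDU decomposition. -/
theorem exists_lower_diagonal_upper {k : Type*} [Field k] :
    ∀ (n : ℕ) (A : Matrix (Fin n) (Fin n) k),
      (∀ (j : ℕ) (h : j < n), (A.submatrix (Fin.castLE h.le) (Fin.castLE h.le)).det ≠ 0) →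
      ∃ (L U : Matrix (Fin n) (Fin n) k) (d : Fin n → k),
        (∀ s t, s < t → L s t = 0) ∧ (∀ s, L s s = 1) ∧
        (∀ s t, t < s → U s t = 0) ∧ (∀ s, U s s = 1) ∧
        (∀ s : Fin n, (s : ℕ) < n - 1 → d s ≠ 0) ∧ A = L * diagonal d * U
  | 0, A, _ => ⟨1, 1, 0, fun s => s.elim0, fun s => s.elim0, fun s => s.elim0, fun s => s.elim0,
      fun s => s.elim0, Subsingleton.elim _ _⟩
  | n + 1, A, hA => by
    obtain ⟨L, U, d, hL, hL1, hU, hU1, -, h⟩ := exists_lower_diagonal_upper n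
      (A.submatrix Fin.castSucc Fin.castSucc) fun j hj => hA j (hj.trans n.lt_succ_self)
    have hdet : (A.submatrix Fin.castSucc Fin.castSucc).det ≠ 0 := hA n n.lt_succ_self
    rw [h, det_mul, det_mul] at hdet
    have hLd : (L * diagonal d).det ≠ 0 := by
      rw [det_mul]; exact left_ne_zero_of_mul hdet
    have hdU : (diagonal d * U).det ≠ 0 := by
      rw [det_mul]
      exact mul_ne_zero (right_ne_zero_of_mul (left_ne_zero_of_mul hdet))
        (right_ne_zero_of_mul hdet)
    have hd : ∀ s, d s ≠ 0 := by
      have := right_ne_zero_of_mul (left_ne_zero_of_mul hdet)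
      rw [det_diagonal, Finset.prod_ne_zero_iff] at this
      exact fun s => this s (Finset.mem_univ s)
    obtain ⟨x, hx⟩ : ∃ x, (L * diagonal d) *ᵥ x = fun i => A i.castSucc (Fin.last n) :=
      ⟨(L * diagonal d)⁻¹ *ᵥ _, by
        rw [mulVec_mulVec, mul_nonsing_inv _ hLd.isUnit, one_mulVec]⟩
    obtain ⟨y, hy⟩ : ∃ y, y ᵥ* (diagonal d * U) = fun i => A (Fin.last n) i.castSucc :=
      ⟨_ ᵥ* (diagonal d * U)⁻¹, by
        rw [vecMul_vecMul, nonsing_inv_mul _ hdU.isUnit, vecMul_one]⟩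
    refine ⟨of (Fin.snoc (α := fun _ => Fin (n + 1) → k)
        (fun i => Fin.snoc (α := fun _ => k) (L i) 0) (Fin.snoc (α := fun _ => k) y 1)),
      of (Fin.snoc (α := fun _ => Fin (n + 1) → k)
        (fun i => Fin.snoc (α := fun _ => k) (U i) (x i)) (Fin.snoc (α := fun _ => k) 0 1)),
      Fin.snoc (α := fun _ => k) d (A (Fin.last n) (Fin.last n) - ∑ i, y i * d i * x i),
      ?_, ?_, ?_, ?_, ?_, ?_⟩
    · intro s t hst
      induction s using Fin.lastCases with
      | last => exact absurd hst (Fin.le_last t).not_gt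
      | cast s =>
        induction t using Fin.lastCases with
        | last => simp
        | cast t => simpa using hL s t (by simpa using hst)
    · intro s
      induction s using Fin.lastCases <;> simp [hL1]
    · intro s t hst
      induction t using Fin.lastCases with
      | last => exact absurd hst (Fin.le_last s).not_gt
      | cast t =>
        induction s using Fin.lastCases with
        | last => simp
        | cast s => simpa using hU s t (by simpa using hst)
    · intro s
      induction s using Fin.lastCases <;> simp [hU1]
    · intro s hs
      induction s using Fin.lastCases with
      | last => simp at hs
      | cast s => simpa using hd s
    · ext i j
      rw [mul_apply]
      simp only [mul_diagonal]
      induction i using Fin.lastCases with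
      | last =>
        induction j using Fin.lastCases with
        | last => simp [Fin.sum_univ_castSucc]
        | cast j =>
          have := congrFun hy j
          simp only [vecMul, dotProduct, diagonal_mul] at this
          simp [Fin.sum_univ_castSucc, ← this, mul_assoc]
      | cast i =>
        induction j using Fin.lastCases with
        | last =>
          have := congrFun hx i
          simp only [mulVec, dotProduct, mul_diagonal] at this
          simp [Fin.sum_univ_castSucc, ← this]
        | cast j =>
          have := congrFun (congrFun h i) j
          rw [mul_apply] at this
          simp only [submatrix_apply, mul_diagonal] at this
          simp [Fin.sum_univ_castSucc, this]

/-- A singular matrix is a product whose right factor has a prescribed row equal to zero. -/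
theorem exists_mul_eq_of_det_eq_zero {k ι : Type*} [Field k] [Fintype ι] [DecidableEq ι]
    (M : Matrix ι ι k) (hM : M.det = 0) (l : ι) :
    ∃ X Y : Matrix ι ι k, M = X * Y ∧ ∀ j, Y l j = 0 := by
  obtain ⟨v, hv, hMv⟩ := exists_mulVec_eq_zero_iff.mpr hM
  obtain ⟨i, hi⟩ := Function.ne_iff.mp hv
  simp only [Pi.zero_apply] at hi
  refine ⟨M.submatrix id (Equiv.swap i l),
    (1 - vecMulVec v (Pi.single i (v i)⁻¹)).submatrix (Equiv.swap i l) id, ?_, fun j => ?_⟩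
  · rw [submatrix_mul_equiv, submatrix_id_id, mul_sub, mul_one, mul_vecMulVec, hMv,
      zero_vecMulVec, sub_zero]
  · by_cases h : j = i
    · simp [h, vecMulVec_apply, hi]
    · simp [h, vecMulVec_apply, Ne.symm h]

end Matrix


theorem stmt3 (k : Type*) [Field k] [IsAlgClosed k] [CharZero k] (n : ℕ) (hn : 1 ≤ n)
    (p : MvPolynomial (Fin n × Fin n) k)
    (hvan : ∀ (ub u : Matrix (Fin n) (Fin n) k) (d : Fin n → k),
      (∀ s t : Fin n, s < t → ub s t = 0) → (∀ s : Fin n, ub s s = 1) →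
      (∀ s t : Fin n, t < s → u s t = 0) → (∀ s : Fin n, u s s = 1) →
      (∀ s : Fin n, (s : ℕ) < n - 1 → d s ≠ 0) → d ⟨n - 1, by omega⟩ = 0 →
      MvPolynomial.eval
        (fun st : Fin n × Fin n => (ub * Matrix.diagonal d * u) st.1 st.2) p = 0) :
    ∀ M : Matrix (Fin n) (Fin n) k, M.det = 0 →
      MvPolynomial.eval (fun st : Fin n × Fin n => M st.1 st.2) p = 0 := by
  intro M hM
  set l : Fin n := ⟨n - 1, by omega⟩ with hl
  obtain ⟨X, Y, rfl, hY⟩ := M.exists_mul_eq_of_det_eq_zero hM l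
  let E : Matrix (Fin n) (Fin n) k := Matrix.diagonal fun i => if i = l then 0 else 1
  -- The curve of singular matrices from `X * Y` (at `0`) to `E` (at `1`).
  let N : Matrix (Fin n) (Fin n) (Polynomial k) :=
    (X.map Polynomial.C + (Polynomial.X : Polynomial k) • (1 - X).map Polynomial.C) *
      (Y.map Polynomial.C + (Polynomial.X : Polynomial k) • (E - Y).map Polynomial.C)
  have hN : ∀ t : k, N.map (Polynomial.evalRingHom t) =
      (X + t • (1 - X)) * (Y + t • (E - Y)) := by
    intro t
    rw [Matrix.map_mul]
    congr 1 <;> ext i j <;> simp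
  let g : Polynomial k :=
    ∏ j : Fin n, (N.submatrix (Fin.castLE j.2.le) (Fin.castLE j.2.le)).det
  have hgt : ∀ t : k, g.eval t = ∏ j : Fin n, (((X + t • (1 - X)) * (Y + t • (E - Y))).submatrix
      (Fin.castLE j.2.le) (Fin.castLE j.2.le)).det := by
    intro t
    simp only [g, Polynomial.eval_prod, ← hN]
    refine Finset.prod_congr rfl fun j _ => ?_
    rw [← Polynomial.coe_evalRingHom, RingHom.map_det]
    rfl
  have hg : g ≠ 0 := by
    intro h0
    have h1 := hgt 1
    rw [h0, Polynomial.eval_zero, eq_comm, Finset.prod_eq_zero_iff] at h1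
    obtain ⟨j, -, hj⟩ := h1
    have hE : E.submatrix (Fin.castLE j.2.le) (Fin.castLE j.2.le) = 1 := by
      rw [Matrix.submatrix_diagonal _ _ (Fin.castLE_injective _), ← Matrix.diagonal_one]
      congr 1
      ext i
      have hi : Fin.castLE j.2.le i ≠ l := by
        simp only [hl, ne_eq, Fin.ext_iff, Fin.val_castLE]
        omega
      simp [hi]
    simp [hE] at hj
  have hcurve := MvPolynomial.eval_curve_eq_zero p (fun st => N st.1 st.2) g hg ?_ 0
  · have h0 := hN 0
    simp only [zero_smul, add_zero] at h0
    rw [← h0]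
    exact hcurve
  · intro t ht
    rw [hgt, Finset.prod_ne_zero_iff] at ht
    obtain ⟨L, U, d, hL, hL1, hU, hU1, hd, h⟩ := Matrix.exists_lower_diagonal_upper n
      ((X + t • (1 - X)) * (Y + t • (E - Y))) fun j hj => ht ⟨j, hj⟩ (Finset.mem_univ _)
    have hdet : ((X + t • (1 - X)) * (Y + t • (E - Y))).det = 0 := by
      rw [Matrix.det_mul, Matrix.det_eq_zero_of_row_eq_zero (A := Y + t • (E - Y)) l, mul_zero]
      intro j
      by_cases hj : l = j
      · subst hj
        simp [E, hY]
      · simp [E, hY, hj]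
    have hLdet : L.det = 1 := by
      rw [Matrix.det_of_isLowerTriangular L fun s t hst => hL s t hst]
      simp [hL1]
    have hUdet : U.det = 1 := by
      rw [Matrix.det_of_isUpperTriangular fun s t hst => hU s t hst]
      simp [hU1]
    rw [h, Matrix.det_mul, Matrix.det_mul, hLdet, hUdet, one_mul, mul_one, Matrix.det_diagonal,
      Finset.prod_eq_zero_iff] at hdet
    obtain ⟨s, -, hs⟩ := hdet
    have hsl : s = l := by
      have hlt : ¬ (s : ℕ) < n - 1 := fun h => hd s h hs
      apply Fin.ext
      change (s : ℕ) = n - 1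
      omega
    have := hvan L U d hL hL1 hU hU1 hd (hsl ▸ hs)
    rw [← h, ← hN] at this
    exact this
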